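/- Regularity in Osband's principle: in the setting of Osband's principle (F convex, T : F → A ⊆ ℝ^k surjective with strict F-identification function V and strictly F-consistent scoring function S, assumptions (V1) and (S1) holding), if additionally (V0) holds: for every F ∈ F the map x ↦ V̄(x,F) is continuous on int(A), then the function h : int(A) → ℝ^{k×k} satisfying ∂_l S̄(x,F) = Σ_{m=1}^k h_{lm}(x) V̄_m(x,F) for all l, x ∈ int(A), F ∈ F is continuous. If additionally (V2) holds: V̄(·,F) is continuously differentiable on int(A) for every F ∈ F, and (S3) holds: for every F ∈ F, S̄(·,F) is continuously differentiable on int(A) with locally Lipschitz continuous gradient and is twice continuously differentiable at T(F) whenever T(F) ∈ int(A), then h is locally Lipschitz continuous. -/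

import Mathlib

open MeasureTheory Set

/-- A scoring function (with the required integrability) that is `𝓕`-consistent for `T`. -/
def IsConsistentScoring {E X : Type*} [MeasurableSpace E]
    (𝓕 : Set (Measure E)) (A : Set X) (T : Measure E → X) (S : X → E → ℝ) : Prop :=
  (∀ μ ∈ 𝓕, ∀ x ∈ A, Integrable (S x) μ) ∧
  ∀ μ ∈ 𝓕, ∀ x ∈ A, (∫ y, S (T μ) y ∂μ) ≤ ∫ y, S x y ∂μ

/-- A strictly `𝓕`-consistent scoring function for `T`. -/
def IsStrictlyConsistentScoring {E X : Type*} [MeasurableSpace E]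
    (𝓕 : Set (Measure E)) (A : Set X) (T : Measure E → X) (S : X → E → ℝ) : Prop :=
  IsConsistentScoring 𝓕 A T S ∧
  ∀ μ ∈ 𝓕, ∀ x ∈ A, (∫ y, S (T μ) y ∂μ) = (∫ y, S x y ∂μ) → x = T μ

/-- A strict `𝓕`-identification function for `T` (including the required integrability). -/
def IsStrictIdentification {E : Type*} [MeasurableSpace E] {k : ℕ}
    (𝓕 : Set (Measure E)) (A : Set (EuclideanSpace ℝ (Fin k)))
    (T : Measure E → EuclideanSpace ℝ (Fin k))
    (V : EuclideanSpace ℝ (Fin k) → E → EuclideanSpace ℝ (Fin k)) : Prop :=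
  (∀ μ ∈ 𝓕, ∀ x ∈ A, Integrable (V x) μ) ∧
  ∀ μ ∈ 𝓕, ∀ x ∈ A, ((∫ y, V x y ∂μ) = 0 ↔ x = T μ)

/-- A convex class of measures: stable under mixtures `(1-λ)F₀ + λF₁`, `λ ∈ (0,1)`. -/
def ConvexClass {E : Type*} [MeasurableSpace E] (𝓕 : Set (Measure E)) : Prop :=
  ∀ μ ∈ 𝓕, ∀ ν ∈ 𝓕, ∀ lam ∈ Set.Ioo (0 : ℝ) 1,
    ENNReal.ofReal (1 - lam) • μ + ENNReal.ofReal lam • ν ∈ 𝓕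

/-- `f` is locally Lipschitz continuous on the set `U`. -/
def LocLipschitzOn {α β : Type*} [PseudoEMetricSpace α] [PseudoEMetricSpace β]
    (f : α → β) (U : Set α) : Prop :=
  ∀ x ∈ U, ∃ ε > (0 : ℝ), ∃ K : NNReal, LipschitzOnWith K f (EMetric.ball x (ENNReal.ofReal ε) ∩ U)

open Topology Filter

/-- A convex set of pairs whose first components cover a neighbourhood of `0`, and which contains
no pair `(0, u)` with `u ≠ 0`, lies on the graph of a linear map. -/
lemma Convex.exists_linearMap_of_fst_mem_nhds {W U : Type*} [NormedAddCommGroup W]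
    [NormedSpace ℝ W] [AddCommGroup U] [Module ℝ U] {P : Set (W × U)} (hP : Convex ℝ P)
    (h0 : Prod.fst '' P ∈ 𝓝 (0 : W)) (hz : ∀ p ∈ P, p.1 = 0 → p.2 = 0) :
    ∃ L : W →ₗ[ℝ] U, ∀ p ∈ P, p.2 = L p.1 := by
  have hcov : ∀ w : W, ∃ t : ℝ, 0 ≤ t ∧ ∃ p ∈ P, t • p.1 = w := by
    intro w
    have ht : Tendsto (fun s : ℝ => s • w) (𝓝[>] 0) (𝓝 0) := by
      have : Tendsto (fun s : ℝ => s • w) (𝓝 0) (𝓝 ((0 : ℝ) • w)) := by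
        apply Continuous.tendsto; fun_prop
      rw [zero_smul] at this
      exact this.mono_left nhdsWithin_le_nhds
    obtain ⟨s, ⟨p, hp, hpw⟩, hs⟩ := ((ht.eventually_mem h0).and self_mem_nhdsWithin).exists
    have hs' : (0 : ℝ) < s := hs
    refine ⟨s⁻¹, by positivity, p, hp, ?_⟩
    rw [hpw, smul_smul, inv_mul_cancel₀ hs'.ne', one_smul]
  have hadd : ∀ t : ℝ, 0 ≤ t → ∀ p ∈ P, ∀ s : ℝ, 0 ≤ s → ∀ q ∈ P,
      ∃ r : ℝ, 0 ≤ r ∧ ∃ z ∈ P, r • z = t • p + s • q := by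
    intro t ht p hp s hs q hq
    rcases (add_nonneg ht hs).eq_or_lt with h | h
    · have h1 : t = 0 := by linarith
      have h2 : s = 0 := by linarith
      exact ⟨0, le_rfl, p, hp, by simp [h1, h2]⟩
    · refine ⟨t + s, h.le, (t / (t + s)) • p + (s / (t + s)) • q,
        hP hp hq (by positivity) (by positivity) (by field_simp), ?_⟩
      rw [smul_add, smul_smul, smul_smul, mul_div_cancel₀ _ h.ne', mul_div_cancel₀ _ h.ne']
  have hcone : ∀ t : ℝ, ∀ p ∈ P, (t • p).1 = 0 → (t • p).2 = 0 := by
    intro t p hp h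
    rcases smul_eq_zero.1 h with h | h
    · simp [h]
    · simp [hz p hp h]
  have hneg : ∀ t : ℝ, 0 ≤ t → ∀ p ∈ P, ∃ r : ℝ, 0 ≤ r ∧ ∃ z ∈ P, r • z = -(t • p) := by
    intro t ht p hp
    obtain ⟨s, hs, q, hq, hsq⟩ := hcov (-(t • p.1))
    obtain ⟨r, -, z, hzP, hrz⟩ := hadd t ht p hp s hs q hq
    have h1 : (r • z).1 = 0 := by simp [hrz, hsq]
    have h2 := hcone r z hzP h1
    refine ⟨s, hs, q, hq, eq_neg_of_add_eq_zero_right ?_⟩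
    rw [← hrz]
    exact Prod.ext h1 h2
  obtain ⟨p₀, hp₀⟩ : P.Nonempty := by
    obtain ⟨p, hp, -⟩ := mem_of_mem_nhds h0
    exact ⟨p, hp⟩
  let G : Submodule ℝ (W × U) :=
    { carrier := {z | ∃ t : ℝ, 0 ≤ t ∧ ∃ p ∈ P, t • p = z}
      zero_mem' := ⟨0, le_rfl, p₀, hp₀, zero_smul _ _⟩
      add_mem' := by
        rintro _ _ ⟨t, ht, p, hp, rfl⟩ ⟨s, hs, q, hq, rfl⟩
        exact hadd t ht p hp s hs q hq
      smul_mem' := by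
        rintro c _ ⟨t, ht, p, hp, rfl⟩
        rcases le_total 0 c with hc | hc
        · exact ⟨c * t, by positivity, p, hp, mul_smul _ _ _⟩
        · obtain ⟨r, hr, z, hzP, h⟩ := hneg (-c * t) (mul_nonneg (by linarith) ht) p hp
          refine ⟨r, hr, z, hzP, ?_⟩
          rw [h, smul_smul, ← neg_smul]
          congr 1
          ring }
  obtain ⟨L, hL⟩ : ∃ L : W →ₗ[ℝ] U, G = L.graph := by
    apply Submodule.exists_eq_graph
    constructor
    · have : Function.Injective (LinearMap.fst ℝ W U ∘ₗ G.subtype) := by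
        rw [injective_iff_map_eq_zero]
        rintro ⟨_, t, ht, p, hp, rfl⟩ h
        exact Subtype.ext (Prod.ext h (hcone t p hp h))
      exact this
    · intro w
      obtain ⟨t, ht, p, hp, h⟩ := hcov w
      exact ⟨⟨t • p, t, ht, p, hp, rfl⟩, h⟩
  refine ⟨L, fun p hp => ?_⟩
  have : p ∈ G := ⟨1, zero_le_one, p, hp, one_smul _ _⟩
  rw [hL] at this
  exact this

lemma LocLipschitzOn.exists_mem_nhds {α β : Type*} [PseudoEMetricSpace α] [PseudoEMetricSpace β]
    {f : α → β} {U : Set α} (hf : LocLipschitzOn f U) (hU : IsOpen U) {x : α} (hx : x ∈ U) :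
    ∃ K, ∃ t ∈ 𝓝 x, LipschitzOnWith K f t := by
  obtain ⟨ε, hε, K, hK⟩ := hf x hx
  exact ⟨K, _, inter_mem (Metric.eball_mem_nhds x (by simpa using hε)) (hU.mem_nhds hx), hK⟩

lemma locLipschitzOn_of_exists_mem_nhds {α β : Type*} [PseudoEMetricSpace α] [PseudoEMetricSpace β]
    {f : α → β} {U : Set α} (hf : ∀ x ∈ U, ∃ K, ∃ t ∈ 𝓝 x, LipschitzOnWith K f t) :
    LocLipschitzOn f U := by
  intro x hx
  obtain ⟨K, t, ht, hK⟩ := hf x hx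
  obtain ⟨ε, hε, hball⟩ := Metric.nhds_basis_eball.mem_iff.1 ht
  obtain ⟨δ, hδ0, hδ⟩ := ENNReal.lt_iff_exists_real_btwn.1 hε
  refine ⟨δ, by simpa using hδ.1, K, hK.mono fun y hy => hball ?_⟩
  exact lt_trans (Metric.mem_eball.1 hy.1) hδ.2

/-- The linear map sending the `j`-th standard basis vector to `(q j).2`. -/
noncomputable def columnMap {k : ℕ}
    (q : Fin k → (EuclideanSpace ℝ (Fin k) →L[ℝ] ℝ) × EuclideanSpace ℝ (Fin k)) :
    EuclideanSpace ℝ (Fin k) →L[ℝ] EuclideanSpace ℝ (Fin k) :=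
  ∑ j, (EuclideanSpace.proj j : EuclideanSpace ℝ (Fin k) →L[ℝ] ℝ).smulRight (q j).2

lemma columnMap_apply {k : ℕ}
    (q : Fin k → (EuclideanSpace ℝ (Fin k) →L[ℝ] ℝ) × EuclideanSpace ℝ (Fin k))
    (w : EuclideanSpace ℝ (Fin k)) : columnMap q w = ∑ j, w j • (q j).2 := by
  simp [columnMap]

lemma contDiff_columnMap {k : ℕ} : ContDiff ℝ 1 (columnMap (k := k)) := by
  unfold columnMap
  refine ContDiff.sum fun j _ => ?_
  have h := (ContinuousLinearMap.smulRightL ℝ (EuclideanSpace ℝ (Fin k))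
    (EuclideanSpace ℝ (Fin k)) (EuclideanSpace.proj j)).contDiff (n := 1)
  exact h.comp (by fun_prop)

/-- The matrix of the linear map sending `(q j).2` to `(q j).1` for every `j`, provided the vectors
`(q j).2` form a basis. -/
noncomputable def solutionMatrix {k : ℕ}
    (q : Fin k → (EuclideanSpace ℝ (Fin k) →L[ℝ] ℝ) × EuclideanSpace ℝ (Fin k))
    (l m : Fin k) : ℝ :=
  ∑ j, (Ring.inverse (columnMap q) (EuclideanSpace.single m 1)) j *
    (q j).1 (EuclideanSpace.single l 1)

lemma contDiffAt_solutionMatrix {k : ℕ}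
    {q : Fin k → (EuclideanSpace ℝ (Fin k) →L[ℝ] ℝ) × EuclideanSpace ℝ (Fin k)}
    (hq : IsUnit (columnMap q)) : ContDiffAt ℝ 1 solutionMatrix q := by
  have hinv : ContDiffAt ℝ 1 (fun p => Ring.inverse (columnMap (k := k) p)) q := by
    obtain ⟨u, hu⟩ := hq
    have := contDiffAt_ringInverse ℝ (n := 1) u
    rw [hu] at this
    exact this.comp q contDiff_columnMap.contDiffAt
  refine contDiffAt_pi.2 fun l => contDiffAt_pi.2 fun m => ?_
  unfold solutionMatrix
  refine ContDiffAt.sum fun j _ => ContDiffAt.mul ?_ ?_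
  · exact (EuclideanSpace.proj j : EuclideanSpace ℝ (Fin k) →L[ℝ] ℝ).contDiff.contDiffAt.comp q
      (hinv.clm_apply contDiffAt_const)
  · exact ContDiffAt.clm_apply (by fun_prop) contDiffAt_const

lemma solutionMatrix_eq {k : ℕ}
    {q : Fin k → (EuclideanSpace ℝ (Fin k) →L[ℝ] ℝ) × EuclideanSpace ℝ (Fin k)}
    (hq : IsUnit (columnMap q))
    (L : EuclideanSpace ℝ (Fin k) →ₗ[ℝ] EuclideanSpace ℝ (Fin k) →L[ℝ] ℝ)
    (hL : ∀ j, (q j).1 = L (q j).2) (l m : Fin k) :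
    solutionMatrix q l m = L (EuclideanSpace.single m 1) (EuclideanSpace.single l 1) := by
  have h : columnMap q (Ring.inverse (columnMap q) (EuclideanSpace.single m 1)) =
      EuclideanSpace.single m 1 := by
    rw [← mul_apply_eq_comp, Ring.mul_inverse_cancel _ hq,
      one_apply_eq_self]
  conv_rhs => rw [← h, columnMap_apply]
  simp [solutionMatrix, hL]

lemma exists_lipschitzOnWith_mem_nhds_pi_prod {ι X Y Z : Type*} [Fintype ι] [PseudoEMetricSpace X]
    [PseudoEMetricSpace Y] [PseudoEMetricSpace Z] {f : ι → X → Y} {g : ι → X → Z} {x : X}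
    (hf : ∀ i, ∃ K, ∃ t ∈ 𝓝 x, LipschitzOnWith K (f i) t)
    (hg : ∀ i, ∃ K, ∃ t ∈ 𝓝 x, LipschitzOnWith K (g i) t) :
    ∃ K, ∃ t ∈ 𝓝 x, LipschitzOnWith K (fun z i => (f i z, g i z)) t := by
  choose K t ht hK using hf
  choose K' t' ht' hK' using hg
  refine ⟨Finset.univ.sup fun i => max (K i) (K' i), ⋂ i, t i ∩ t' i,
    (iInter_mem).2 fun i => inter_mem (ht i) (ht' i), fun y hy z hz => ?_⟩
  refine edist_pi_le_iff.2 fun i => ?_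
  have hy := mem_iInter.1 hy i
  have hz := mem_iInter.1 hz i
  refine (((hK i).mono inter_subset_left).prodMk ((hK' i).mono inter_subset_right) hy hz).trans ?_
  gcongr
  exact Finset.le_sup (f := fun i => max (K i) (K' i)) (Finset.mem_univ i)

lemma integral_mixture {E F : Type*} [MeasurableSpace E] [NormedAddCommGroup F] [NormedSpace ℝ F]
    {μ ν : Measure E} {f : E → F} (hμ : Integrable f μ) (hν : Integrable f ν) {a b : ℝ}
    (ha : 0 ≤ a) (hb : 0 ≤ b) :
    ∫ y, f y ∂(ENNReal.ofReal a • μ + ENNReal.ofReal b • ν) =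
      a • ∫ y, f y ∂μ + b • ∫ y, f y ∂ν := by
  rw [integral_add_measure (hμ.smul_measure ENNReal.ofReal_ne_top)
    (hν.smul_measure ENNReal.ofReal_ne_top), integral_smul_measure, integral_smul_measure,
    ENNReal.toReal_ofReal ha, ENNReal.toReal_ofReal hb]

/-- **regularity in Osband's principle.** Under (V1), (S1) and (V0), the
matrix-valued function `h` of Osband's principle is continuous on `int(A)`; if moreover
(V2) and (S3) hold, then `h` is locally Lipschitz continuous on `int(A)`. -/
theorem statement11 {E : Type*} [MeasurableSpace E] {k : ℕ}
    (𝓕 : Set (Measure E)) (hprob : ∀ μ ∈ 𝓕, IsProbabilityMeasure μ)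
    (hconv : ConvexClass 𝓕)
    (A : Set (EuclideanSpace ℝ (Fin k)))
    (T : Measure E → EuclideanSpace ℝ (Fin k)) (hT : ∀ μ ∈ 𝓕, T μ ∈ A)
    (hsurj : ∀ x ∈ A, ∃ μ ∈ 𝓕, T μ = x)
    (V : EuclideanSpace ℝ (Fin k) → E → EuclideanSpace ℝ (Fin k))
    (hV : IsStrictIdentification 𝓕 A T V)
    (S : EuclideanSpace ℝ (Fin k) → E → ℝ)
    (hS : IsStrictlyConsistentScoring 𝓕 A T S)
    -- Assumption (V1):
    (hV1 : ∀ x ∈ interior A, ∃ G : Fin (k + 1) → Measure E, (∀ i, G i ∈ 𝓕) ∧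
      (0 : EuclideanSpace ℝ (Fin k)) ∈
        interior (convexHull ℝ (Set.range fun i => ∫ y, V x y ∂(G i))))
    -- Assumption (S1):
    (hS1 : ∀ μ ∈ 𝓕, ContDiffOn ℝ 1 (fun x => ∫ y, S x y ∂μ) (interior A))
    -- Assumption (V0):
    (hV0 : ∀ μ ∈ 𝓕, ContinuousOn (fun x => ∫ y, V x y ∂μ) (interior A)) :
    ∃ h : EuclideanSpace ℝ (Fin k) → Fin k → Fin k → ℝ,
      (∀ x ∈ interior A, ∀ μ ∈ 𝓕, ∀ l : Fin k,
        fderiv ℝ (fun z => ∫ y, S z y ∂μ) x (EuclideanSpace.single l 1) =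
          ∑ m : Fin k, h x l m * (∫ y, V x y ∂μ) m) ∧
      ContinuousOn h (interior A) ∧
      -- under (V2) and (S3), `h` is locally Lipschitz on `int(A)`:
      (((∀ μ ∈ 𝓕, ContDiffOn ℝ 1 (fun x => ∫ y, V x y ∂μ) (interior A)) ∧
        (∀ μ ∈ 𝓕,
          ContDiffOn ℝ 1 (fun x => ∫ y, S x y ∂μ) (interior A) ∧
          LocLipschitzOn (fun x => fderiv ℝ (fun z => ∫ y, S z y ∂μ) x) (interior A) ∧
          (T μ ∈ interior A → ContDiffAt ℝ 2 (fun x => ∫ y, S x y ∂μ) (T μ)))) →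
        LocLipschitzOn h (interior A)) := by
  have hdiff : ∀ μ ∈ 𝓕, ∀ x ∈ interior A, DifferentiableAt ℝ (fun z => ∫ y, S z y ∂μ) x :=
    fun μ hμ x hx => ((hS1 μ hμ).differentiableOn one_ne_zero).differentiableAt
      (isOpen_interior.mem_nhds hx)
  let P : EuclideanSpace ℝ (Fin k) →
      Set (EuclideanSpace ℝ (Fin k) × (EuclideanSpace ℝ (Fin k) →L[ℝ] ℝ)) := fun x =>
    (fun μ => (∫ y, V x y ∂μ, fderiv ℝ (fun z => ∫ y, S z y ∂μ) x)) '' 𝓕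
  have hPconv : ∀ x ∈ interior A, Convex ℝ (P x) := by
    intro x hx
    rw [convex_iff_forall_pos]
    rintro _ ⟨μ, hμ, rfl⟩ _ ⟨ν, hν, rfl⟩ a b ha hb hab
    obtain rfl : a = 1 - b := by linarith
    refine ⟨_, hconv μ hμ ν hν b ⟨hb, by linarith⟩, ?_⟩
    refine Prod.ext ?_ ?_
    · exact integral_mixture (hV.1 μ hμ x (interior_subset hx)) (hV.1 ν hν x (interior_subset hx))
        ha.le hb.le
    · have hev : (fun z => ∫ y, S z y ∂(ENNReal.ofReal (1 - b) • μ + ENNReal.ofReal b • ν)) =ᶠ[𝓝 x]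
          fun z => (1 - b) • (∫ y, S z y ∂μ) + b • ∫ y, S z y ∂ν := by
        filter_upwards [isOpen_interior.mem_nhds hx] with z hz
        exact integral_mixture (hS.1.1 μ hμ z (interior_subset hz))
          (hS.1.1 ν hν z (interior_subset hz)) ha.le hb.le
      exact (((hdiff μ hμ x hx).hasFDerivAt.const_smul (1 - b)).add
        ((hdiff ν hν x hx).hasFDerivAt.const_smul b)).congr_of_eventuallyEq hev |>.fderiv
  have hPzero : ∀ x ∈ interior A, ∀ p ∈ P x, p.1 = 0 → p.2 = 0 := by
    rintro x hx _ ⟨μ, hμ, rfl⟩ h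
    have hTx : x = T μ := (hV.2 μ hμ x (interior_subset hx)).1 h
    apply IsLocalMin.fderiv_eq_zero
    filter_upwards [isOpen_interior.mem_nhds hx] with z hz
    have := hS.1.2 μ hμ z (interior_subset hz)
    rwa [← hTx] at this
  have hPnhds : ∀ x ∈ interior A, Prod.fst '' P x ∈ 𝓝 0 := by
    intro x hx
    obtain ⟨G, hG, h0⟩ := hV1 x hx
    refine mem_of_superset (mem_interior_iff_mem_nhds.1 h0) (convexHull_min ?_ ?_)
    · rintro _ ⟨i, rfl⟩
      exact ⟨_, ⟨G i, hG i, rfl⟩, rfl⟩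
    · exact (hPconv x hx).linear_image (LinearMap.fst ℝ _ _)
  have hexists : ∀ x, ∃ L : EuclideanSpace ℝ (Fin k) →ₗ[ℝ] EuclideanSpace ℝ (Fin k) →L[ℝ] ℝ,
      x ∈ interior A → ∀ p ∈ P x, p.2 = L p.1 := by
    intro x
    by_cases hx : x ∈ interior A
    · obtain ⟨L, hL⟩ :=
        (hPconv x hx).exists_linearMap_of_fst_mem_nhds (hPnhds x hx) (hPzero x hx)
      exact ⟨L, fun _ => hL⟩
    · exact ⟨0, fun h => absurd h hx⟩
  choose L hL using hexists
  have hLμ : ∀ x ∈ interior A, ∀ μ ∈ 𝓕,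
      fderiv ℝ (fun z => ∫ y, S z y ∂μ) x = L x (∫ y, V x y ∂μ) :=
    fun x hx μ hμ => hL x hx _ ⟨μ, hμ, rfl⟩
  let h : EuclideanSpace ℝ (Fin k) → Fin k → Fin k → ℝ :=
    fun x l m => L x (EuclideanSpace.single m 1) (EuclideanSpace.single l 1)
  -- Near each point, `h` is given by `solutionMatrix` for finitely many fixed measures.
  have hlocal : ∀ x ∈ interior A, ∃ ν : Fin k → Measure E, (∀ j, ν j ∈ 𝓕) ∧
      ContinuousAt (fun z j => (fderiv ℝ (fun w => ∫ y, S w y ∂(ν j)) z, ∫ y, V z y ∂(ν j))) x ∧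
      ContDiffAt ℝ 1 solutionMatrix
        (fun j => (fderiv ℝ (fun w => ∫ y, S w y ∂(ν j)) x, ∫ y, V x y ∂(ν j))) ∧
      h =ᶠ[𝓝 x] fun z => solutionMatrix
        (fun j => (fderiv ℝ (fun w => ∫ y, S w y ∂(ν j)) z, ∫ y, V z y ∂(ν j))) := by
    intro x hx
    obtain ⟨ε, hε, hball⟩ := Metric.mem_nhds_iff.1 (hPnhds x hx)
    have hν : ∀ j : Fin k, ∃ ν ∈ 𝓕, ∫ y, V x y ∂ν = EuclideanSpace.single j (ε / 2) := by
      intro j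
      have hmem : EuclideanSpace.single j (ε / 2) ∈ Metric.ball (0 : EuclideanSpace ℝ (Fin k)) ε := by
        rw [mem_ball_zero_iff, PiLp.norm_single, Real.norm_of_nonneg (by positivity)]
        linarith
      obtain ⟨_, ⟨ν, hν, rfl⟩, h⟩ := hball hmem
      exact ⟨ν, hν, h⟩
    choose ν hν𝓕 hν using hν
    have hcont : ContinuousAt
        (fun z j => (fderiv ℝ (fun w => ∫ y, S w y ∂(ν j)) z, ∫ y, V z y ∂(ν j))) x := by
      refine continuousAt_pi.2 fun j => ContinuousAt.prodMk ?_ ?_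
      · exact ((hS1 _ (hν𝓕 j)).continuousOn_fderiv_of_isOpen isOpen_interior
          le_rfl).continuousAt (isOpen_interior.mem_nhds hx)
      · exact (hV0 _ (hν𝓕 j)).continuousAt (isOpen_interior.mem_nhds hx)
    have hunit : IsUnit (columnMap
        (fun j => (fderiv ℝ (fun w => ∫ y, S w y ∂(ν j)) x, ∫ y, V x y ∂(ν j)))) := by
      have hcol : columnMap
          (fun j => (fderiv ℝ (fun w => ∫ y, S w y ∂(ν j)) x, ∫ y, V x y ∂(ν j))) =
          algebraMap ℝ _ (ε / 2) := by
        ext w i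
        simp [columnMap_apply, hν, Algebra.algebraMap_eq_smul_one, Pi.single_apply, mul_comm]
      rw [hcol]
      exact (IsUnit.mk0 _ (by positivity)).map (algebraMap ℝ _)
    refine ⟨ν, hν𝓕, hcont, contDiffAt_solutionMatrix hunit, ?_⟩
    have hev := (contDiff_columnMap.continuous.continuousAt.comp hcont).eventually_mem
      (Units.isOpen.mem_nhds hunit)
    filter_upwards [hev, isOpen_interior.mem_nhds hx] with z hz hzA
    ext l m
    exact (solutionMatrix_eq hz (L z) (fun j => hLμ z hzA _ (hν𝓕 j)) l m).symm
  refine ⟨h, ?_, ?_, ?_⟩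
  · intro x hx μ hμ l
    rw [hLμ x hx μ hμ]
    conv_lhs => rw [← (EuclideanSpace.basisFun (Fin k) ℝ).sum_repr (∫ y, V x y ∂μ)]
    simp [h, mul_comm]
  · intro x hx
    obtain ⟨ν, -, hcont, hsol, heq⟩ := hlocal x hx
    exact ((ContinuousAt.comp (f := fun z j =>
      (fderiv ℝ (fun w => ∫ y, S w y ∂(ν j)) z, ∫ y, V z y ∂(ν j)))
      hsol.continuousAt hcont).congr heq.symm).continuousWithinAt
  · rintro ⟨hV2, hS3⟩
    refine locLipschitzOn_of_exists_mem_nhds fun x hx => ?_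
    obtain ⟨ν, hν𝓕, hcont, hsol, heq⟩ := hlocal x hx
    obtain ⟨K, t, ht, hK⟩ := exists_lipschitzOnWith_mem_nhds_pi_prod
      (f := fun j z => fderiv ℝ (fun w => ∫ y, S w y ∂(ν j)) z) (g := fun j z => ∫ y, V z y ∂(ν j))
      (fun j => (hS3 _ (hν𝓕 j)).2.1.exists_mem_nhds isOpen_interior hx)
      (fun j => ((hV2 _ (hν𝓕 j)).contDiffAt
        (isOpen_interior.mem_nhds hx)).exists_lipschitzOnWith)
    obtain ⟨K', t', ht', hK'⟩ := hsol.exists_lipschitzOnWith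
    obtain ⟨s, hs, hsub⟩ := heq.exists_mem
    refine ⟨K' * K, _, inter_mem (inter_mem ht (hcont ht')) hs, fun y hy z hz => ?_⟩
    rw [hsub hy.2, hsub hz.2]
    exact (hK'.comp (hK.mono inter_subset_left) fun z hz => hz.2) hy.1 hz.1
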